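/- Under the hypotheses of the previous statement, if moreover the ideal generated by the leading coefficients aₙ and bₘ is all of R (i.e., d = 1), then coker(ψⱼ) ≅ coker(ψₖ) as R-modules for all 0 ≤ j, k ≤ m. In particular the cokernel of the Sylvester matrix of f and g is isomorphic to the cokernel of the hybrid Bézout matrix of f and g. -/

import Mathlib

open Polynomial

/-- The polynomial `pₖ = gₖ·f − fₖ·g`, where `fₖ` and `gₖ` are the top parts of `f` and `g`
(of respective degrees at most `n` and `m`). -/
noncomputable def hybridP {R : Type*} [CommRing R] (f g : R[X]) (n m k : ℕ) : R[X] :=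
  (∑ j ∈ Finset.range (k + 1), C (g.coeff (m - k + j)) * X ^ j) * f -
    (∑ j ∈ Finset.range (n - m + k + 1), C (f.coeff (m - k + j)) * X ^ j) * g

theorem hybrid_sum_mem {R : Type*} [CommRing R] (c : ℕ → R) (k : ℕ) :
    (∑ j ∈ Finset.range (k + 1), C (c j) * X ^ j : R[X]) ∈ degreeLT R (k + 1) := by
  refine Submodule.sum_mem _ fun i hi => ?_
  rw [mem_degreeLT]
  refine lt_of_le_of_lt (degree_C_mul_X_pow_le i _) ?_
  exact_mod_cast Finset.mem_range.mp hi

theorem hybrid_sum_coeff {R : Type*} [CommRing R] (c : ℕ → R) (k : ℕ) :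
    (∑ j ∈ Finset.range (k + 1), C (c j) * X ^ j : R[X]).coeff k = c k := by
  simp [coeff_C_mul, coeff_X_pow]

theorem mem_degreeLT_coeff {R : Type*} [CommRing R] (p : R[X]) (k : ℕ) :
    p ∈ degreeLT R k ↔ ∀ i, k ≤ i → p.coeff i = 0 := by
  rw [mem_degreeLT, degree_lt_iff_coeff_zero]

theorem mem_degreeLT_pred {R : Type*} [CommRing R] (p : R[X]) (k : ℕ)
    (hp : p ∈ degreeLT R (k + 1)) (h : p.coeff k = 0) : p ∈ degreeLT R k := by
  rw [mem_degreeLT_coeff] at *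
  intro i hi
  rcases Nat.eq_or_lt_of_le hi with rfl | hi
  · exact h
  · exact hp i hi

theorem coeff_top_mul {R : Type*} [CommRing R] (u f : R[X]) (a n s : ℕ)
    (hu : u ∈ degreeLT R (a + 1)) (hf : f.natDegree ≤ n) (hs : s = a + n) :
    (u * f).coeff s = u.coeff a * f.coeff n := by
  subst hs
  refine coeff_mul_add_eq_of_natDegree_le ?_ hf
  rw [natDegree_le_iff_coeff_eq_zero]
  intro i hi
  exact (mem_degreeLT_coeff _ _).1 hu i hi

set_option maxHeartbeats 1000000 in
theorem coker_hybrid_step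
    {R : Type*} [CommRing R] (n m : ℕ) (hmn : m ≤ n)
    (f g : R[X]) (hf : f.natDegree ≤ n) (hg : g.natDegree ≤ m)
    (hgen : Ideal.span {f.coeff n, g.coeff m} = (⊤ : Ideal R))
    (Ψ : (j : ℕ) → ((Fin j → R) × (↥(degreeLT R (m - j)) × ↥(degreeLT R (n - j)))) →ₗ[R]
      ↥(degreeLT R (m + n - j)))
    (hΨ : ∀ j ≤ m, ∀ x : (Fin j → R) × (↥(degreeLT R (m - j)) × ↥(degreeLT R (n - j))),
      ((Ψ j x : R[X])) =
        (∑ i : Fin j, x.1 i • hybridP f g n m (m - j + (i : ℕ))) +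
          (x.2.1 : R[X]) * f + (x.2.2 : R[X]) * g)
    (j : ℕ) (hj : j < m) :
    Nonempty ((↥(degreeLT R (m + n - (j + 1))) ⧸ LinearMap.range (Ψ (j + 1))) ≃ₗ[R]
      (↥(degreeLT R (m + n - j)) ⧸ LinearMap.range (Ψ j))) := by
  obtain ⟨α, β, hαβ⟩ := Ideal.mem_span_pair.1 ((Ideal.eq_top_iff_one _).1 hgen)
  -- degree of the hybrid polynomials
  have hp : ∀ k < m, hybridP f g n m k ∈ degreeLT R n := by
    intro k hk
    have h := (Ψ m (Pi.single ⟨k, hk⟩ 1, 0, 0)).2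
    rw [hΨ m le_rfl] at h
    simpa [Pi.single_apply, ite_smul] using h
  obtain ⟨a, ha⟩ : ∃ a, m = j + a + 1 := ⟨m - j - 1, by omega⟩
  obtain ⟨b, hb⟩ : ∃ b, n = j + b + 1 := ⟨n - j - 1, by omega⟩
  have e1 : m - j = a + 1 := by omega
  have e2 : n - j = b + 1 := by omega
  have e3 : m - (j + 1) = a := by omega
  have e4 : n - (j + 1) = b := by omega
  obtain ⟨G, F, hG, hF, hGc, hFc, hP⟩ : ∃ G F : R[X], G ∈ degreeLT R (a + 1) ∧
      F ∈ degreeLT R (b + 1) ∧ G.coeff a = g.coeff m ∧ F.coeff b = f.coeff n ∧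
      hybridP f g n m a = G * f - F * g := by
    have e5 : n - m + a = b := by omega
    refine ⟨_, _, hybrid_sum_mem (fun i => g.coeff (m - a + i)) a,
      hybrid_sum_mem (fun i => f.coeff (m - a + i)) b, ?_, ?_, ?_⟩
    · rw [hybrid_sum_coeff]; congr 1; omega
    · rw [hybrid_sum_coeff]; congr 1; omega
    · rw [hybridP, e5]
  have hle : degreeLT R (m + n - (j + 1)) ≤ degreeLT R (m + n - j) :=
    degreeLT_mono (by omega)
  have hsumtop : ∀ c : Fin j → R,
      (∑ i : Fin j, c i • hybridP f g n m (m - j + (i : ℕ))).coeff (m + n - (j + 1)) = 0 := by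
    intro c
    have : (∑ i : Fin j, c i • hybridP f g n m (m - j + (i : ℕ))) ∈ degreeLT R n :=
      Submodule.sum_mem _ fun i _ => Submodule.smul_mem _ _ (hp _ (by omega))
    exact (mem_degreeLT_coeff _ _).1 this _ (by omega)
  have hsum : ∀ (s : R) (c : Fin j → R),
      (∑ i : Fin (j + 1), (Fin.cons s c : Fin (j + 1) → R) i •
        hybridP f g n m (m - (j + 1) + (i : ℕ))) =
      s • hybridP f g n m a + ∑ i : Fin j, c i • hybridP f g n m (m - j + (i : ℕ)) := by
    intro s c
    rw [Fin.sum_univ_succ]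
    simp only [Fin.cons_zero, Fin.cons_succ, Fin.val_zero, Fin.val_succ, e3, e1, add_zero]
    refine congrArg (fun z => s • hybridP f g n m a + z) (Finset.sum_congr rfl fun i _ => ?_)
    rw [show a + ((i : ℕ) + 1) = a + 1 + i by omega]
  let φ := (LinearMap.range (Ψ j)).mkQ ∘ₗ Submodule.inclusion hle
  have hsurj : Function.Surjective φ := by
    intro q
    obtain ⟨y, rfl⟩ := Submodule.mkQ_surjective _ q
    set t := (y : R[X]).coeff (m + n - (j + 1)) with ht
    have hu : C (t * α) * X ^ a ∈ degreeLT R (m - j) := by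
      rw [e1, mem_degreeLT]
      exact lt_of_le_of_lt (degree_C_mul_X_pow_le _ _) (by exact_mod_cast Nat.lt_succ_self a)
    have hv : C (t * β) * X ^ b ∈ degreeLT R (n - j) := by
      rw [e2, mem_degreeLT]
      exact lt_of_le_of_lt (degree_C_mul_X_pow_le _ _) (by exact_mod_cast Nat.lt_succ_self b)
    let x : (Fin j → R) × (↥(degreeLT R (m - j)) × ↥(degreeLT R (n - j))) :=
      (0, ⟨_, hu⟩, ⟨_, hv⟩)
    have hx : ((Ψ j x : R[X])) = C (t * α) * X ^ a * f + C (t * β) * X ^ b * g := by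
      rw [hΨ j hj.le]; simp [x]
    have hz : ((y - Ψ j x : ↥(degreeLT R (m + n - j))) : R[X]) ∈
        degreeLT R (m + n - (j + 1)) := by
      apply mem_degreeLT_pred
      · rw [show m + n - (j + 1) + 1 = m + n - j by omega]
        exact (y - Ψ j x).2
      · rw [Submodule.coe_sub, coeff_sub, hx, coeff_add,
          coeff_top_mul _ f a n _ (by rw [← e1]; exact hu) hf (by omega),
          coeff_top_mul _ g b m _ (by rw [← e2]; exact hv) hg (by omega), ← ht]
        simp only [coeff_C_mul, coeff_X_pow, if_true, mul_one]
        linear_combination (-t) * hαβ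
    refine ⟨⟨_, hz⟩, ?_⟩
    simp only [φ, LinearMap.comp_apply, Submodule.mkQ_apply]
    rw [Submodule.Quotient.eq]
    refine ⟨-x, ?_⟩
    apply Subtype.ext
    simp
  have hker : LinearMap.ker φ = LinearMap.range (Ψ (j + 1)) := by
    ext y
    simp only [φ, LinearMap.mem_ker, LinearMap.comp_apply, Submodule.mkQ_apply,
      Submodule.Quotient.mk_eq_zero, LinearMap.mem_range]
    constructor
    · rintro ⟨⟨c, ⟨u, hu⟩, ⟨v, hv⟩⟩, hx⟩
      have hx := congrArg (Subtype.val) hx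
      rw [hΨ j hj.le] at hx
      simp only [Submodule.coe_inclusion] at hx
      have hu' := hu
      have hv' := hv
      rw [e1] at hu'
      rw [e2] at hv'
      have htop : u.coeff a * f.coeff n + v.coeff b * g.coeff m = 0 := by
        have h := congrArg (fun p => coeff p (m + n - (j + 1))) hx
        simp only [coeff_add, hsumtop] at h
        rw [coeff_top_mul u f a n _ hu' hf (by omega),
          coeff_top_mul v g b m _ hv' hg (by omega),
          (mem_degreeLT_coeff _ _).1 y.2 _ le_rfl] at h
        simpa using h
      set s := β * u.coeff a - α * v.coeff b with hs
      have hu2 : u - C s * G ∈ degreeLT R (m - (j + 1)) := by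
        rw [e3]
        apply mem_degreeLT_pred
        · rw [← smul_eq_C_mul]
          exact Submodule.sub_mem _ hu' (Submodule.smul_mem _ _ hG)
        · rw [coeff_sub, coeff_C_mul, hGc, hs]
          linear_combination (-u.coeff a) * hαβ + α * htop
      have hv2 : v + C s * F ∈ degreeLT R (n - (j + 1)) := by
        rw [e4]
        apply mem_degreeLT_pred
        · rw [← smul_eq_C_mul]
          exact Submodule.add_mem _ hv' (Submodule.smul_mem _ _ hF)
        · rw [coeff_add, coeff_C_mul, hFc, hs]
          linear_combination (-v.coeff b) * hαβ + β * htop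
      refine ⟨(Fin.cons s c, ⟨_, hu2⟩, ⟨_, hv2⟩), ?_⟩
      apply Subtype.ext
      rw [hΨ (j + 1) hj, ← hx]
      simp only
      rw [hsum, hP, smul_eq_C_mul]
      ring
    · rintro ⟨⟨c, ⟨u, hu⟩, ⟨v, hv⟩⟩, hx⟩
      have hx := congrArg (Subtype.val) hx
      rw [hΨ (j + 1) hj] at hx
      simp only at hx
      rw [← Fin.cons_self_tail c, hsum, hP, smul_eq_C_mul] at hx
      have hu2 : u + C (c 0) * G ∈ degreeLT R (m - j) := by
        refine Submodule.add_mem _ (degreeLT_mono (by omega) hu) ?_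
        rw [← smul_eq_C_mul, e1]
        exact Submodule.smul_mem _ _ hG
      have hv2 : v - C (c 0) * F ∈ degreeLT R (n - j) := by
        refine Submodule.sub_mem _ (degreeLT_mono (by omega) hv) ?_
        rw [← smul_eq_C_mul, e2]
        exact Submodule.smul_mem _ _ hF
      refine ⟨(Fin.tail c, ⟨_, hu2⟩, ⟨_, hv2⟩), ?_⟩
      apply Subtype.ext
      rw [hΨ j hj.le, Submodule.coe_inclusion, ← hx]
      simp only
      ring
  exact ⟨(Submodule.quotEquivOfEq _ _ hker.symm).trans
    (LinearMap.quotKerEquivOfSurjective φ hsurj)⟩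

/-- If the top coefficients `aₙ` of `f` and `bₘ` of `g` generate the unit ideal, then the
cokernels of all the hybrid resultant maps `ψⱼ`, `0 ≤ j ≤ m` (with `ψ₀` the Sylvester map and
`ψₘ` the hybrid Bézout map), are pairwise isomorphic as `R`-modules. -/
theorem coker_hybrid_maps_iso
    (R : Type*) [CommRing R] (n m : ℕ) (hm : 1 ≤ m) (hmn : m ≤ n)
    (f g : R[X]) (hf : f.natDegree ≤ n) (hg : g.natDegree ≤ m)
    (hgen : Ideal.span {f.coeff n, g.coeff m} = (⊤ : Ideal R))
    (Ψ : (j : ℕ) → ((Fin j → R) × (↥(degreeLT R (m - j)) × ↥(degreeLT R (n - j)))) →ₗ[R]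
      ↥(degreeLT R (m + n - j)))
    (hΨ : ∀ j ≤ m, ∀ x : (Fin j → R) × (↥(degreeLT R (m - j)) × ↥(degreeLT R (n - j))),
      ((Ψ j x : R[X])) =
        (∑ i : Fin j, x.1 i • hybridP f g n m (m - j + (i : ℕ))) +
          (x.2.1 : R[X]) * f + (x.2.2 : R[X]) * g)
    (j k : ℕ) (hj : j ≤ m) (hk : k ≤ m) :
    Nonempty ((↥(degreeLT R (m + n - j)) ⧸ LinearMap.range (Ψ j)) ≃ₗ[R]
      (↥(degreeLT R (m + n - k)) ⧸ LinearMap.range (Ψ k))) := by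
  have key : ∀ i ≤ m, Nonempty ((↥(degreeLT R (m + n - i)) ⧸ LinearMap.range (Ψ i)) ≃ₗ[R]
      (↥(degreeLT R (m + n - 0)) ⧸ LinearMap.range (Ψ 0))) := by
    intro i
    induction i with
    | zero => exact fun _ => ⟨LinearEquiv.refl R _⟩
    | succ i ih =>
      intro hi
      obtain ⟨e⟩ := ih (by omega)
      obtain ⟨e'⟩ := coker_hybrid_step n m hmn f g hf hg hgen Ψ hΨ i hi
      exact ⟨e'.trans e⟩
  obtain ⟨e⟩ := key j hj
  obtain ⟨e'⟩ := key k hk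
  exact ⟨e.trans e'.symm⟩
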